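/- arXiv:2605.05093 — 2 statements merged into one kernel-verified Lean document; each statement's English description precedes it below -/
import Mathlib

section
/- (Group-dropping step in the proof of Lemma 2.) Let G = {1,…,p} be the full collection of group indices and let S ⊆ G. If x ∈ K^S, then the Euclidean projection of x onto K^G equals its Euclidean projection onto K^{G∖S}: P_{K^G}(x) = P_{K^{G∖S}}(x). -/
open scoped BigOperators

/-- Euclidean (ℓ₂) norm of a vector in ℝ^p. -/
noncomputable def l2 {p : ℕ} (v : Fin p → ℝ) : ℝ := Real.sqrt (∑ j, v j ^ 2)

/-- ℓ∞ norm of a vector in ℝ^p. -/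
noncomputable def linf {p : ℕ} (v : Fin p → ℝ) : ℝ := ⨆ j, |v j|

/-- The vector agreeing with `v` on the coordinate set `s` and equal to 0 elsewhere. -/
def restr {p : ℕ} (s : Finset (Fin p)) (v : Fin p → ℝ) : Fin p → ℝ :=
  fun j => if j ∈ s then v j else 0

/-- `K^S = { β : ‖β_{Nᵢ}‖₂ ≤ τ*ᵢ and ‖β_{Nᵢ}‖∞ ≤ ξ*ᵢ for every i ∈ S }`. -/
def Kset {p : ℕ} (N : Fin p → Finset (Fin p)) (τs ξs : Fin p → ℝ) (S : Set (Fin p)) :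
    Set (Fin p → ℝ) :=
  { β | ∀ i ∈ S, l2 (restr (N i) β) ≤ τs i ∧ linf (restr (N i) β) ≤ ξs i }

/-- `y` is a Euclidean projection of `x` onto `K`. -/
def IsProjOn {p : ℕ} (K : Set (Fin p → ℝ)) (x y : Fin p → ℝ) : Prop :=
  y ∈ K ∧ ∀ z ∈ K, l2 (x - y) ≤ l2 (x - z)

theorem l2_le_l2_iff {p : ℕ} (v w : Fin p → ℝ) :
    l2 v ≤ l2 w ↔ ∑ j, v j ^ 2 ≤ ∑ j, w j ^ 2 :=
  Real.sqrt_le_sqrt_iff (Finset.sum_nonneg fun _ _ => sq_nonneg _)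

theorem l2_restr_le_iff {p : ℕ} (s : Finset (Fin p)) (v : Fin p → ℝ) {t : ℝ} (ht : 0 ≤ t) :
    l2 (restr s v) ≤ t ↔ ∑ j ∈ s, v j ^ 2 ≤ t ^ 2 := by
  rw [l2, Real.sqrt_le_left ht]
  simp [restr, ite_pow, Finset.sum_ite_mem]

theorem linf_restr_le_iff {p : ℕ} (s : Finset (Fin p)) (v : Fin p → ℝ) {t : ℝ} (ht : 0 ≤ t) :
    linf (restr s v) ≤ t ↔ ∀ j ∈ s, |v j| ≤ t := by
  constructor
  · intro h j hj
    have hle : |restr s v j| ≤ linf (restr s v) :=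
      le_ciSup (f := fun j => |restr s v j|) (Set.finite_range _).bddAbove j
    simp only [restr, hj, if_true] at hle
    exact hle.trans h
  · intro h
    refine Real.iSup_le (fun j => ?_) ht
    by_cases hj : j ∈ s
    · simpa [restr, hj] using h j hj
    · simpa [restr, hj] using ht

theorem mem_Kset_iff {p : ℕ} {N : Fin p → Finset (Fin p)} {τs ξs : Fin p → ℝ}
    (hτ : ∀ i, 0 < τs i) (hξ : ∀ i, 0 < ξs i) {S : Set (Fin p)} {v : Fin p → ℝ} :
    v ∈ Kset N τs ξs S ↔
      ∀ i ∈ S, ∑ j ∈ N i, v j ^ 2 ≤ τs i ^ 2 ∧ ∀ j ∈ N i, |v j| ≤ ξs i := by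
  simp only [Kset, Set.mem_ofPred_eq, l2_restr_le_iff _ _ (hτ _).le,
    linf_restr_le_iff _ _ (hξ _).le]

/-- `Kset` is solid: it contains every vector dominated coordinatewise by a member. -/
theorem mem_Kset_of_abs_le {p : ℕ} {N : Fin p → Finset (Fin p)} {τs ξs : Fin p → ℝ}
    (hτ : ∀ i, 0 < τs i) (hξ : ∀ i, 0 < ξs i) {S : Set (Fin p)} {v w : Fin p → ℝ}
    (hv : v ∈ Kset N τs ξs S) (h : ∀ j, |w j| ≤ |v j|) : w ∈ Kset N τs ξs S := by
  rw [mem_Kset_iff hτ hξ] at hv ⊢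
  exact fun i hi => ⟨(Finset.sum_le_sum fun j _ => sq_le_sq.2 (h j)).trans (hv i hi).1,
    fun j hj => (h j).trans ((hv i hi).2 j hj)⟩

theorem midpoint_mem_Kset {p : ℕ} {N : Fin p → Finset (Fin p)} {τs ξs : Fin p → ℝ}
    (hτ : ∀ i, 0 < τs i) (hξ : ∀ i, 0 < ξs i) {S : Set (Fin p)} {v w : Fin p → ℝ}
    (hv : v ∈ Kset N τs ξs S) (hw : w ∈ Kset N τs ξs S) :
    (fun j => (v j + w j) / 2) ∈ Kset N τs ξs S := by
  rw [mem_Kset_iff hτ hξ] at hv hw ⊢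
  refine fun i hi => ⟨?_, fun j hj => ?_⟩
  · have h : ∑ j ∈ N i, ((v j + w j) / 2) ^ 2 ≤ ∑ j ∈ N i, (v j ^ 2 / 2 + w j ^ 2 / 2) :=
      Finset.sum_le_sum fun j _ => by nlinarith [sq_nonneg (v j - w j)]
    rw [Finset.sum_add_distrib, ← Finset.sum_div, ← Finset.sum_div] at h
    linarith [(hv i hi).1, (hw i hi).1]
  · have h₁ := abs_le.1 ((hv i hi).2 j hj)
    have h₂ := abs_le.1 ((hw i hi).2 j hj)
    exact abs_le.2 ⟨by linarith, by linarith⟩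

theorem IsProjOn.unique_of_midpoint_mem {p : ℕ} {K : Set (Fin p → ℝ)} {x y z : Fin p → ℝ}
    (hy : IsProjOn K x y) (hz : IsProjOn K x z) (hm : (fun j => (y j + z j) / 2) ∈ K) :
    y = z := by
  have h₁ := (l2_le_l2_iff _ _).1 (hy.2 _ hm)
  have h₂ := (l2_le_l2_iff _ _).1 (hz.2 _ hm)
  simp only [Pi.sub_apply] at h₁ h₂
  have h : ∑ j, (x j - (y j + z j) / 2) ^ 2 =
      (∑ j, (x j - y j) ^ 2) / 2 + (∑ j, (x j - z j) ^ 2) / 2 - (∑ j, (y j - z j) ^ 2) / 4 := by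
    simp only [Finset.sum_div, ← Finset.sum_add_distrib, ← Finset.sum_sub_distrib]
    exact Finset.sum_congr rfl fun j _ => by ring
  have hnonneg : ∀ j ∈ Finset.univ, 0 ≤ (y j - z j) ^ 2 := fun j _ => sq_nonneg _
  have h0 : ∑ j, (y j - z j) ^ 2 = 0 :=
    le_antisymm (by linarith) (Finset.sum_nonneg hnonneg)
  funext j
  have hj := (Finset.sum_eq_zero_iff_of_nonneg hnonneg).1 h0 j (Finset.mem_univ j)
  exact sub_eq_zero.1 (pow_eq_zero_iff two_ne_zero |>.1 hj)

/-- Projecting onto a solid set does not increase any coordinate in absolute value. -/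
theorem IsProjOn.abs_le_of_solid {p : ℕ} {K : Set (Fin p → ℝ)} {x z : Fin p → ℝ}
    (hK : ∀ v ∈ K, ∀ w : Fin p → ℝ, (∀ j, |w j| ≤ |v j|) → w ∈ K)
    (hz : IsProjOn K x z) (j : Fin p) : |z j| ≤ |x j| := by
  by_contra! hj
  have hmem : Function.update z j (x j) ∈ K := hK z hz.1 _ fun k => by
    rcases eq_or_ne k j with rfl | hk
    · simpa using hj.le
    · simp [hk]
  have hle := (l2_le_l2_iff _ _).1 (hz.2 _ hmem)
  refine hle.not_gt (Finset.sum_lt_sum (fun k _ => ?_) ⟨j, Finset.mem_univ j, ?_⟩)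
  · rcases eq_or_ne k j with rfl | hk
    · simpa using sq_nonneg (x k - z k)
    · simp [hk]
  · have hne : x j - z j ≠ 0 := fun h => hj.ne (by rw [sub_eq_zero.1 h])
    simpa using pow_pos (abs_pos.2 hne) 2

/-- group-dropping step in the proof of Lemma 2: if `x ∈ K^S` with
`S ⊆ G = {1,…,p}`, then the projection of `x` onto `K^G` equals its projection
onto `K^{G∖S}`. -/
theorem stmt3 {p : ℕ} (N : Fin p → Finset (Fin p)) (τs ξs : Fin p → ℝ)
    (hτ : ∀ i, 0 < τs i) (hξ : ∀ i, 0 < ξs i)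
    (S : Set (Fin p)) (x : Fin p → ℝ)
    (hx : x ∈ Kset N τs ξs S)
    (y z : Fin p → ℝ)
    (hy : IsProjOn (Kset N τs ξs Set.univ) x y)
    (hz : IsProjOn (Kset N τs ξs (Set.univ \ S)) x z) :
    y = z := by
  have habs := hz.abs_le_of_solid fun v hv w h => mem_Kset_of_abs_le hτ hξ hv h
  have hzS := mem_Kset_of_abs_le hτ hξ hx habs
  have hzG : z ∈ Kset N τs ξs Set.univ := fun i _ => by
    by_cases hi : i ∈ S
    · exact hzS i hi
    · exact hz.1 i ⟨trivial, hi⟩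
  have hz' : IsProjOn (Kset N τs ξs Set.univ) x z :=
    ⟨hzG, fun w hw => hz.2 w fun i _ => hw i trivial⟩
  exact hy.unique_of_midpoint_mem hz' (midpoint_mem_Kset hτ hξ hy.1 hzG)
end

section
/- (Lemma: the SGLIG regularizer is a norm.) The function R : ℝ^p → ℝ defined below is a norm on ℝ^p: R(β) ≥ 0 with R(β) = 0 if and only if β = 0; R(cβ) = |c| R(β) for all scalars c ∈ ℝ; and R(β + β′) ≤ R(β) + R(β′) for all β, β′ ∈ ℝ^p. -/
open scoped BigOperators

/-- ℓ₁ norm of a vector in ℝ^p. -/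
noncomputable def l1 {p : ℕ} (v : Fin p → ℝ) : ℝ := ∑ j, |v j|

/-- The SGLIG regularizer
`R(β) = inf { ∑ᵢ (α τᵢ ‖V⁽ⁱ⁾‖₂ + (1−α) √dᵢ ‖V⁽ⁱ⁾‖₁) : supp V⁽ⁱ⁾ ⊆ Nᵢ, ∑ᵢ V⁽ⁱ⁾ = β }`,
where `dᵢ = |Nᵢ|`. -/
noncomputable def Rreg {p : ℕ} (N : Fin p → Finset (Fin p)) (τ : Fin p → ℝ) (α : ℝ)
    (β : Fin p → ℝ) : ℝ :=
  sInf { r : ℝ | ∃ V : Fin p → Fin p → ℝ,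
    (∀ i, ∀ j, j ∉ N i → V i j = 0) ∧ (∑ i, V i) = β ∧
    r = ∑ i, (α * τ i * l2 (V i) + (1 - α) * Real.sqrt ((N i).card) * l1 (V i)) }

theorem l2_eq_norm {p : ℕ} (v : Fin p → ℝ) : l2 v = ‖WithLp.toLp 2 v‖ := by
  simp [l2, EuclideanSpace.norm_eq]

theorem l2_nonneg {p : ℕ} (v : Fin p → ℝ) : 0 ≤ l2 v := Real.sqrt_nonneg _

theorem l2_add_le {p : ℕ} (v w : Fin p → ℝ) : l2 (v + w) ≤ l2 v + l2 w := by
  simpa only [l2_eq_norm, WithLp.toLp_add] using norm_add_le (WithLp.toLp 2 v) (WithLp.toLp 2 w)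

theorem l2_smul {p : ℕ} (c : ℝ) (v : Fin p → ℝ) : l2 (c • v) = |c| * l2 v := by
  simp only [l2_eq_norm, WithLp.toLp_smul, norm_smul, Real.norm_eq_abs]

theorem abs_apply_le_l2 {p : ℕ} (v : Fin p → ℝ) (j : Fin p) : |v j| ≤ l2 v :=
  Real.abs_le_sqrt
    (Finset.single_le_sum (f := fun k => v k ^ 2) (fun k _ => sq_nonneg (v k)) (Finset.mem_univ j))

theorem l1_nonneg {p : ℕ} (v : Fin p → ℝ) : 0 ≤ l1 v :=
  Finset.sum_nonneg fun _ _ => abs_nonneg _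

theorem l1_add_le {p : ℕ} (v w : Fin p → ℝ) : l1 (v + w) ≤ l1 v + l1 w := by
  simp only [l1, ← Finset.sum_add_distrib]
  exact Finset.sum_le_sum fun j _ => abs_add_le (v j) (w j)

theorem l1_smul {p : ℕ} (c : ℝ) (v : Fin p → ℝ) : l1 (c • v) = |c| * l1 v := by
  simp [l1, abs_mul, Finset.mul_sum]

theorem abs_apply_le_l1 {p : ℕ} (v : Fin p → ℝ) (j : Fin p) : |v j| ≤ l1 v :=
  Finset.single_le_sum (f := fun k => |v k|) (fun k _ => abs_nonneg (v k)) (Finset.mem_univ j)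

/-- The objective minimized by `Rreg`. -/
noncomputable def regCost {p : ℕ} (N : Fin p → Finset (Fin p)) (τ : Fin p → ℝ) (α : ℝ)
    (V : Fin p → Fin p → ℝ) : ℝ :=
  ∑ i, (α * τ i * l2 (V i) + (1 - α) * Real.sqrt ((N i).card) * l1 (V i))

/-- `V` is a decomposition of `β` subordinate to the neighborhoods `N`. -/
def IsDecomposition {p : ℕ} (N : Fin p → Finset (Fin p)) (β : Fin p → ℝ)
    (V : Fin p → Fin p → ℝ) : Prop :=
  (∀ i, ∀ j, j ∉ N i → V i j = 0) ∧ ∑ i, V i = β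

namespace IsDecomposition

variable {p : ℕ} {N : Fin p → Finset (Fin p)} {β β' : Fin p → ℝ} {V V' : Fin p → Fin p → ℝ}

theorem add (h : IsDecomposition N β V) (h' : IsDecomposition N β' V') :
    IsDecomposition N (β + β') (V + V') :=
  ⟨fun i j hj => by simp [h.1 i j hj, h'.1 i j hj],
    by simp [Finset.sum_add_distrib, h.2, h'.2]⟩

theorem smul (c : ℝ) (h : IsDecomposition N β V) : IsDecomposition N (c • β) (c • V) :=
  ⟨fun i j hj => by simp [h.1 i j hj], by simp [← Finset.smul_sum, h.2]⟩

/-- Putting `β i` in the `i`-th group decomposes `β`. -/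
theorem diagonal (hN : ∀ i, i ∈ N i) (β : Fin p → ℝ) :
    IsDecomposition N β fun i => Pi.single i (β i) :=
  ⟨fun i j hj => Pi.single_eq_of_ne (fun h : j = i => hj (h ▸ hN i)) _, Finset.univ_sum_single β⟩

end IsDecomposition

section Regularizer

variable {p : ℕ} {N : Fin p → Finset (Fin p)} {τ : Fin p → ℝ} {α : ℝ}

theorem regCost_smul (c : ℝ) (V : Fin p → Fin p → ℝ) :
    regCost N τ α (c • V) = |c| * regCost N τ α V := by
  simp only [regCost, Pi.smul_apply, l1_smul, l2_smul, Finset.mul_sum]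
  exact Finset.sum_congr rfl fun i _ => by ring

theorem regCost_nonneg (hτ : ∀ i, 0 < τ i) (hα : 0 ≤ α ∧ α ≤ 1) (V : Fin p → Fin p → ℝ) :
    0 ≤ regCost N τ α V :=
  Finset.sum_nonneg fun i _ => add_nonneg
    (mul_nonneg (mul_nonneg hα.1 (hτ i).le) (l2_nonneg _))
    (mul_nonneg (mul_nonneg (sub_nonneg.2 hα.2) (Real.sqrt_nonneg _)) (l1_nonneg _))

theorem regCost_add_le (hτ : ∀ i, 0 < τ i) (hα : 0 ≤ α ∧ α ≤ 1) (V V' : Fin p → Fin p → ℝ) :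
    regCost N τ α (V + V') ≤ regCost N τ α V + regCost N τ α V' := by
  simp only [regCost, ← Finset.sum_add_distrib]
  refine Finset.sum_le_sum fun i _ => ?_
  have h₂ := mul_le_mul_of_nonneg_left (l2_add_le (V i) (V' i)) (mul_nonneg hα.1 (hτ i).le)
  have h₁ := mul_le_mul_of_nonneg_left (l1_add_le (V i) (V' i))
    (mul_nonneg (sub_nonneg.2 hα.2) (Real.sqrt_nonneg (N i).card))
  simp only [Pi.add_apply]
  linarith

/-- The objective dominates each coordinate of the decomposed vector, with a uniform constant. -/
theorem exists_pos_mul_abs_le_regCost (hN : ∀ i, i ∈ N i) (hτ : ∀ i, 0 < τ i)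
    (hα : 0 ≤ α ∧ α ≤ 1) :
    ∃ c : ℝ, 0 < c ∧ ∀ β V, IsDecomposition N β V → ∀ j, c * |β j| ≤ regCost N τ α V := by
  have hw : ∀ i, 0 < α * τ i + (1 - α) * Real.sqrt (N i).card := fun i => by
    have hd : 0 < Real.sqrt (N i).card :=
      Real.sqrt_pos.2 (Nat.cast_pos.2 (Finset.card_pos.2 ⟨i, hN i⟩))
    rcases hα.1.eq_or_lt with h | h
    · simpa [← h] using hd
    · exact add_pos_of_pos_of_nonneg (mul_pos h (hτ i))
        (mul_nonneg (sub_nonneg.2 hα.2) hd.le)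
  obtain ⟨c, hc, hcw⟩ : ∃ c : ℝ, 0 < c ∧ ∀ i, c ≤ α * τ i + (1 - α) * Real.sqrt (N i).card := by
    rcases isEmpty_or_nonempty (Fin p) with _ | _
    · exact ⟨1, one_pos, isEmptyElim⟩
    · obtain ⟨i₀, hi₀⟩ := Finite.exists_min fun i => α * τ i + (1 - α) * Real.sqrt (N i).card
      exact ⟨_, hw i₀, hi₀⟩
  refine ⟨c, hc, fun β V hV j => ?_⟩
  calc c * |β j| = c * |∑ i, V i j| := by rw [← hV.2, Finset.sum_apply]
    _ ≤ c * ∑ i, |V i j| := mul_le_mul_of_nonneg_left (Finset.abs_sum_le_sum_abs _ _) hc.le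
    _ = ∑ i, c * |V i j| := Finset.mul_sum _ _ _
    _ ≤ regCost N τ α V := Finset.sum_le_sum fun i _ => by
      have h := mul_le_mul_of_nonneg_right (hcw i) (abs_nonneg (V i j))
      have h₂ := mul_le_mul_of_nonneg_left (abs_apply_le_l2 (V i) j)
        (mul_nonneg hα.1 (hτ i).le)
      have h₁ := mul_le_mul_of_nonneg_left (abs_apply_le_l1 (V i) j)
        (mul_nonneg (sub_nonneg.2 hα.2) (Real.sqrt_nonneg (N i).card))
      linarith

theorem Rreg_le_regCost (hτ : ∀ i, 0 < τ i) (hα : 0 ≤ α ∧ α ≤ 1) {β : Fin p → ℝ}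
    {V : Fin p → Fin p → ℝ} (hV : IsDecomposition N β V) : Rreg N τ α β ≤ regCost N τ α V := by
  refine csInf_le ⟨0, ?_⟩ ⟨V, hV.1, hV.2, rfl⟩
  rintro _ ⟨W, -, -, rfl⟩
  exact regCost_nonneg hτ hα W

theorem le_Rreg (hN : ∀ i, i ∈ N i) {β : Fin p → ℝ} {b : ℝ}
    (h : ∀ V, IsDecomposition N β V → b ≤ regCost N τ α V) : b ≤ Rreg N τ α β := by
  have hβ := IsDecomposition.diagonal hN β
  refine le_csInf ⟨_, _, hβ.1, hβ.2, rfl⟩ ?_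
  rintro _ ⟨V, h₁, h₂, rfl⟩
  exact h V ⟨h₁, h₂⟩

theorem Rreg_nonneg (hN : ∀ i, i ∈ N i) (hτ : ∀ i, 0 < τ i) (hα : 0 ≤ α ∧ α ≤ 1)
    (β : Fin p → ℝ) : 0 ≤ Rreg N τ α β :=
  le_Rreg hN fun V _ => regCost_nonneg hτ hα V

theorem Rreg_add_le (hN : ∀ i, i ∈ N i) (hτ : ∀ i, 0 < τ i) (hα : 0 ≤ α ∧ α ≤ 1)
    (β β' : Fin p → ℝ) : Rreg N τ α (β + β') ≤ Rreg N τ α β + Rreg N τ α β' := by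
  rw [← sub_le_iff_le_add]
  refine le_Rreg hN fun V hV => ?_
  rw [sub_le_comm]
  refine le_Rreg hN fun V' hV' => ?_
  rw [sub_le_iff_le_add']
  exact (Rreg_le_regCost hτ hα (hV.add hV')).trans (regCost_add_le hτ hα V V')

theorem Rreg_zero (hN : ∀ i, i ∈ N i) (hτ : ∀ i, 0 < τ i) (hα : 0 ≤ α ∧ α ≤ 1) :
    Rreg N τ α 0 = 0 := by
  refine le_antisymm ?_ (Rreg_nonneg hN hτ hα 0)
  have h := Rreg_le_regCost hτ hα ((IsDecomposition.diagonal hN 0).smul 0)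
  rwa [regCost_smul, abs_zero, zero_mul, smul_zero] at h

theorem Rreg_smul_le (hN : ∀ i, i ∈ N i) (hτ : ∀ i, 0 < τ i) (hα : 0 ≤ α ∧ α ≤ 1)
    {c : ℝ} (hc : c ≠ 0) (β : Fin p → ℝ) : Rreg N τ α (c • β) ≤ |c| * Rreg N τ α β := by
  rw [← div_le_iff₀' (abs_pos.2 hc)]
  refine le_Rreg hN fun V hV => ?_
  rw [div_le_iff₀' (abs_pos.2 hc), ← regCost_smul]
  exact Rreg_le_regCost hτ hα (hV.smul c)

theorem Rreg_smul (hN : ∀ i, i ∈ N i) (hτ : ∀ i, 0 < τ i) (hα : 0 ≤ α ∧ α ≤ 1)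
    (c : ℝ) (β : Fin p → ℝ) : Rreg N τ α (c • β) = |c| * Rreg N τ α β := by
  rcases eq_or_ne c 0 with rfl | hc
  · simp [Rreg_zero hN hτ hα]
  refine le_antisymm (Rreg_smul_le hN hτ hα hc β) ?_
  have h := Rreg_smul_le hN hτ hα (inv_ne_zero hc) (c • β)
  rwa [inv_smul_smul₀ hc, abs_inv, ← div_eq_inv_mul, le_div_iff₀' (abs_pos.2 hc)] at h

theorem Rreg_eq_zero_iff (hN : ∀ i, i ∈ N i) (hτ : ∀ i, 0 < τ i) (hα : 0 ≤ α ∧ α ≤ 1)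
    (β : Fin p → ℝ) : Rreg N τ α β = 0 ↔ β = 0 := by
  refine ⟨fun h => funext fun j => ?_, fun h => h ▸ Rreg_zero hN hτ hα⟩
  obtain ⟨c, hc, hle⟩ := exists_pos_mul_abs_le_regCost hN hτ hα
  have hj : c * |β j| ≤ 0 := h ▸ le_Rreg hN fun V hV => hle β V hV j
  exact abs_nonpos_iff.1 (nonpos_of_mul_nonpos_right hj hc)

end Regularizer

/-- the SGLIG regularizer is a norm on ℝ^p: it is nonnegative, definite,
absolutely homogeneous, and satisfies the triangle inequality. -/
theorem stmt4 {p : ℕ} (N : Fin p → Finset (Fin p)) (hN : ∀ i, i ∈ N i)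
    (τ : Fin p → ℝ) (hτ : ∀ i, 0 < τ i)
    (α : ℝ) (hα : 0 ≤ α ∧ α ≤ 1) :
    (∀ β : Fin p → ℝ, 0 ≤ Rreg N τ α β) ∧
    (∀ β : Fin p → ℝ, Rreg N τ α β = 0 ↔ β = 0) ∧
    (∀ (c : ℝ) (β : Fin p → ℝ), Rreg N τ α (c • β) = |c| * Rreg N τ α β) ∧
    (∀ β β' : Fin p → ℝ, Rreg N τ α (β + β') ≤ Rreg N τ α β + Rreg N τ α β') := by
  exact ⟨Rreg_nonneg hN hτ hα, Rreg_eq_zero_iff hN hτ hα, Rreg_smul hN hτ hα,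
    Rreg_add_le hN hτ hα⟩
end
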